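/- Let 𝓜 be the improvement MDP of an MDP M and a preference model ⟨𝔽, ⊵⟩, with level sets W_i and R_i as computed by the level-set algorithm. For every k ≥ 1, every s ∈ S with (s,0) ∈ W_k, and every m ∈ {0,1}, there exists a strategy π in 𝓜 such that every play v₀v₁… of 𝓜 consistent with π from v₀ = (s,m) visits 𝓕 at least k times at positive indices: there exist indices 1 ≤ i₁ < i₂ < … < i_k with v_{i_j} ∈ 𝓕 for all j. -/

import Mathlib

/-!
Framework for MDPs with preference models over reachability objectives,
following "Opportunistic Qualitative Planning in Stochastic Systems with
Incomplete Preferences over Reachability Objectives".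
-/

/-- The infinite sequence `ν ρ`: the finite prefix `ν` followed by the suffix `ρ`. -/
def appendSeq {V : Type} (ν : List V) (ρ : ℕ → V) : ℕ → V :=
  fun i => if h : i < ν.length then ν.get ⟨i, h⟩ else ρ (i - ν.length)

/-- The history `s₀ … s_{k+i}`: the prefix `ν = s₀ … s_k` followed by the
first `i` states of the suffix `ρ`. -/
def histSeq {V : Type} (ν : List V) (ρ : ℕ → V) (i : ℕ) : List V :=
  ν ++ (List.range i).map ρ

/-- The state from which the `i`-th action along the suffix is taken:
the last state of `ν` if `i = 0` (the default is irrelevant for nonempty `ν`),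
and `ρ (i-1)` otherwise. -/
def curState {V : Type} (ν : List V) (ρ : ℕ → V) : ℕ → V
  | 0 => ν.getLastD (ρ 0)
  | j + 1 => ρ j

/-- Consistency of an infinite suffix `ρ` with a strategy `π` after the prefix `ν`,
relative to an enabledness relation `Δ`: for every `i ≥ 0` there is an action
`a ∈ π(s₀ … s_{k+i})` with the transition to the next state enabled. -/
def ConsistentRel {V A : Type} (Δ : V → A → V → Prop) (π : List V → Set A)
    (ν : List V) (ρ : ℕ → V) : Prop :=
  ∀ i : ℕ, ∃ a ∈ π (histSeq ν ρ i), Δ (curState ν ρ i) a (ρ i)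

/-- The cone: the set of infinite suffixes of `ν` consistent with `π`. -/
def ConeRel {V A : Type} (Δ : V → A → V → Prop) (ν : List V) (π : List V → Set A) :
    Set (ℕ → V) :=
  { ρ | ConsistentRel Δ π ν ρ }

/-- A Markov decision process with states `S`, actions `A`, transition
probability function `T` and initial state `init`. -/
structure MDP (S A : Type) where
  T : S → A → PMF S
  init : S

namespace MDP

variable {S A : Type}

/-- `T(s,a,s') > 0`. -/
def Enabled (M : MDP S A) (s : S) (a : A) (s' : S) : Prop := M.T s a s' ≠ 0

/-- A play: an infinite state sequence each of whose steps is enabled by some action. -/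
def IsPlay (M : MDP S A) (ρ : ℕ → S) : Prop :=
  ∀ i : ℕ, ∃ a : A, M.Enabled (ρ i) a (ρ (i + 1))

/-- A prefix: a finite nonempty initial segment of a play of `M`. -/
def IsPrefix (M : MDP S A) (ν : List S) : Prop :=
  ν ≠ [] ∧ ∃ ρ : ℕ → S, M.IsPlay ρ ∧ ν = (List.range ν.length).map ρ

/-- `Cone(M, ν, π)`: the suffixes of `ν` consistent with `π` in `M`. -/
def Cone (M : MDP S A) (ν : List S) (π : List S → Set A) : Set (ℕ → S) :=
  ConeRel M.Enabled ν π

end MDP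

/-- `Reach(F)`: the set of infinite sequences visiting a state of `F`. -/
def ReachSet {S : Type} (F : Set S) : Set (ℕ → S) := { ρ | ∃ i : ℕ, ρ i ∈ F }

/-- A preference model `⟨𝔽, ⊵⟩` over reachability objectives: a finite set `objs`
of reachability objectives together with a reflexive and transitive relation
`pref` (`⊵`) on it. -/
structure PrefModel (S : Type) where
  objs : Set (Set (ℕ → S))
  finite : objs.Finite
  isReach : ∀ R ∈ objs, ∃ F : Set S, R = ReachSet F
  pref : Set (ℕ → S) → Set (ℕ → S) → Prop
  refl : ∀ R ∈ objs, pref R R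
  trans : ∀ R ∈ objs, ∀ R' ∈ objs, ∀ R'' ∈ objs,
    pref R R' → pref R' R'' → pref R R''

namespace PrefModel

variable {S A : Type}

/-- Strict preference `R' ▷ R`: `R' ⊵ R` and not `R ⊵ R'`. -/
def SPref (P : PrefModel S) (R' R : Set (ℕ → S)) : Prop :=
  P.pref R' R ∧ ¬ P.pref R R'

/-- `MP(𝕏)`: the most-preferred outcomes in `𝕏`. -/
def MPset (P : PrefModel S) (X : Set (Set (ℕ → S))) : Set (Set (ℕ → S)) :=
  { R | R ∈ X ∧ ¬ ∃ R' ∈ X, P.SPref R' R }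

/-- `Outcomes(ν)`: the objectives in `𝔽` for which some strategy forces every
consistent play `νρ` to satisfy the objective. -/
def Outcomes (M : MDP S A) (P : PrefModel S) (ν : List S) : Set (Set (ℕ → S)) :=
  { R | R ∈ P.objs ∧ ∃ π : List S → Set A,
      (∀ w : List S, (π w).Nonempty) ∧ ∀ ρ ∈ M.Cone ν π, appendSeq ν ρ ∈ R }

/-- `MP(s) = MP(Outcomes(s))` for a state `s`. -/
def MPst (P : PrefModel S) (M : MDP S A) (s : S) : Set (Set (ℕ → S)) :=
  P.MPset (P.Outcomes M [s])

end PrefModel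

/-- `Δ(v,a,v') > 0`: the enabled transitions of the improvement MDP of `M` and `P`.
States are pairs `(s, m)` with `m : Bool` (`true` = memory bit 1). -/
def ImpEnabled {S A : Type} (M : MDP S A) (P : PrefModel S) :
    S × Bool → A → S × Bool → Prop :=
  fun v a v' =>
    M.Enabled v.1 a v'.1 ∧
    (¬ ∃ R ∈ P.MPst M v.1, ∃ R' ∈ P.MPst M v'.1, P.SPref R R') ∧
    (v'.2 = true ↔ ∃ R ∈ P.MPst M v.1, ∃ R' ∈ P.MPst M v'.1, P.SPref R' R)

/-- The final states `𝓕 = S × {1}` of the improvement MDP. -/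
def ImpFinal {S : Type} : Set (S × Bool) := { v | v.2 = true }

/-- Plays of the improvement MDP. -/
def IsImpPlay {S A : Type} (M : MDP S A) (P : PrefModel S) (ϱ : ℕ → S × Bool) : Prop :=
  ∀ i : ℕ, ∃ a : A, ImpEnabled M P (ϱ i) a (ϱ (i + 1))

/-- The almost-sure winning region for visiting `Target`, w.r.t. the enabledness
relation `Δ`: states `v` from which some strategy forces every consistent play
(from the one-state prefix `⟨v⟩`) to visit `Target`. -/
def ASWinSet {V A : Type} (Δ : V → A → V → Prop) (Target : Set V) : Set V :=
  { v | ∃ π : List V → Set A, (∀ w : List V, (π w).Nonempty) ∧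
      ∀ ρ ∈ ConeRel Δ [v] π, ∃ k : ℕ, appendSeq [v] ρ k ∈ Target }

/-- The sets `R_i` of the level-set algorithm: `R₀ = 𝓕`,
`R_{i+1} = {(s,1) ∈ 𝓕 ∣ (s,0) ∈ W_{i+1} = ASWin(R_i)}`. -/
def Rlev {S A : Type} (M : MDP S A) (P : PrefModel S) : ℕ → Set (S × Bool)
  | 0 => ImpFinal
  | i + 1 => { v | v ∈ (ImpFinal : Set (S × Bool)) ∧
      (v.1, false) ∈ ASWinSet (ImpEnabled M P) (Rlev M P i) }

/-- The level sets `W_i = ASWin(R_{i-1})` (meaningful for `i ≥ 1`). -/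
def Wlev {S A : Type} (M : MDP S A) (P : PrefModel S) (i : ℕ) : Set (S × Bool) :=
  ASWinSet (ImpEnabled M P) (Rlev M P (i - 1))

theorem appendSeq_singleton_succ {V : Type} (v : V) (ρ : ℕ → V) (i : ℕ) :
    appendSeq [v] ρ (i + 1) = ρ i := by
  simp [appendSeq]

open Classical in
/-- Play `π`, as if the play had started in `v`, until the first visit to `T` after the initial
state; if that visit is to `x`, forget the earlier history and play `σ x` from then on. -/
noncomputable def switchStrategy {V A : Type} (v : V) (π : List V → Set A)
    (σ : V → List V → Set A) (T : Set V) (w : List V) : Set A :=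
  match w.tail.dropWhile (fun u => decide (u ∉ T)) with
  | [] => π (v :: w.tail)
  | x :: q => σ x (x :: q)

section switchStrategy

variable {V A : Type} {Δ : V → A → V → Prop} {v v' : V} {π : List V → Set A}
  {σ : V → List V → Set A} {T : Set V}

theorem switchStrategy_nonempty (hπ : ∀ w, (π w).Nonempty) (hσ : ∀ x w, (σ x w).Nonempty)
    (w : List V) : (switchStrategy v π σ T w).Nonempty := by
  unfold switchStrategy
  split
  · exact hπ _
  · exact hσ _ _

open Classical in
theorem switchStrategy_of_forall_notMem {l : List V} (hl : ∀ u ∈ l, u ∉ T) :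
    switchStrategy v π σ T (v' :: l) = π (v :: l) := by
  have h : l.dropWhile (fun u => decide (u ∉ T)) = [] := by
    simpa [List.dropWhile_eq_nil_iff] using hl
  simp only [switchStrategy, List.tail_cons]
  rw [h]

open Classical in
theorem switchStrategy_append {p q : List V} {x : V} (hp : ∀ u ∈ p, u ∉ T) (hx : x ∈ T) :
    switchStrategy v π σ T (v' :: (p ++ x :: q)) = σ x (x :: q) := by
  have h : (p ++ x :: q).dropWhile (fun u => decide (u ∉ T)) = x :: q := by
    rw [List.dropWhile_append_of_pos (by simpa using hp), List.dropWhile_cons_of_neg (by simpa)]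
  simp only [switchStrategy, List.tail_cons]
  rw [h]

/-- If `π` forces a visit to `T` from `v`, and every transition from `v'` is also one from `v`, then
every play following `switchStrategy` from `v'` visits `T`, and follows `σ` from that visit on. -/
theorem exists_mem_cone_of_mem_cone_switchStrategy (hΔ : ∀ a u, Δ v' a u → Δ v a u)
    (hπ : ∀ ρ ∈ ConeRel Δ [v] π, ∃ i, ρ i ∈ T) {ρ : ℕ → V}
    (hρ : ρ ∈ ConeRel Δ [v'] (switchStrategy v π σ T)) :
    ∃ n, ρ n ∈ T ∧ (fun i => ρ (n + 1 + i)) ∈ ConeRel Δ [ρ n] (σ (ρ n)) := by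
  classical
  have hex : ∃ n, ρ n ∈ T := by
    by_contra! hno
    obtain ⟨i, hi⟩ := hπ ρ fun i => by
      obtain ⟨a, ha, hstep⟩ := hρ i
      refine ⟨a, ?_, ?_⟩
      · rw [histSeq, List.singleton_append, switchStrategy_of_forall_notMem] at ha
        · exact ha
        · simpa using fun j _ => hno j
      · cases i with
        | zero => exact hΔ _ _ hstep
        | succ j => exact hstep
    exact hno i hi
  refine ⟨Nat.find hex, Nat.find_spec hex, fun i => ?_⟩
  set n := Nat.find hex
  obtain ⟨a, ha, hstep⟩ := hρ (n + 1 + i)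
  refine ⟨a, ?_, ?_⟩
  · have hhist : histSeq [v'] ρ (n + 1 + i) =
        v' :: ((List.range n).map ρ ++
          ρ n :: (List.range i).map fun j => ρ (n + 1 + j)) := by
      simp [histSeq, List.range_add, List.range_succ, Function.comp_def]
    rw [hhist, switchStrategy_append _ (Nat.find_spec hex)] at ha
    · exact ha
    · simp only [List.mem_map, List.mem_range]
      rintro _ ⟨j, hj, rfl⟩
      exact Nat.find_min hex hj
  · cases i with
    | zero => exact hstep
    | succ j => exact hstep

end switchStrategy

section Improvement

variable {S A : Type} {M : MDP S A} {P : PrefModel S}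

theorem Rlev_subset_ImpFinal (n : ℕ) : Rlev M P n ⊆ ImpFinal := by
  cases n with
  | zero => exact subset_rfl
  | succ n => exact fun _ hv => hv.1

/-- A winning strategy for `Rlev M P n` from a state with memory `0` visits it after the start. -/
theorem exists_strategy_of_mem_ASWinSet {s : S} {n : ℕ}
    (h : (s, false) ∈ ASWinSet (ImpEnabled M P) (Rlev M P n)) :
    ∃ π : List (S × Bool) → Set A, (∀ w, (π w).Nonempty) ∧
      ∀ ρ ∈ ConeRel (ImpEnabled M P) [(s, false)] π, ∃ i, ρ i ∈ Rlev M P n := by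
  obtain ⟨π, hne, hπ⟩ := h
  refine ⟨π, hne, fun ρ hρ => ?_⟩
  obtain ⟨i, hi⟩ := hπ ρ hρ
  cases i with
  | zero => exact absurd (Rlev_subset_ImpFinal n hi) (by simp [appendSeq, ImpFinal])
  | succ j => exact ⟨j, appendSeq_singleton_succ (s, false) ρ j ▸ hi⟩

/-- From `Rlev M P n`, and from its copy with memory `0`, some strategy forces `n` further visits
to the final states. -/
theorem exists_strategy_visits [Nonempty A] (n : ℕ) : ∀ v : S × Bool,
    (v.1, true) ∈ Rlev M P n → ∃ π : List (S × Bool) → Set A, (∀ w, (π w).Nonempty) ∧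
      ∀ ρ ∈ ConeRel (ImpEnabled M P) [v] π,
        ∃ f : Fin n → ℕ, StrictMono f ∧ ∀ j, ρ (f j) ∈ ImpFinal := by
  induction n with
  | zero =>
    exact fun v _ => ⟨fun _ => Set.univ, fun _ => Set.univ_nonempty, fun _ _ =>
      ⟨Fin.elim0, fun j => j.elim0, fun j => j.elim0⟩⟩
  | succ n ih =>
    rintro ⟨s, m⟩ ⟨-, hwin⟩
    obtain ⟨π, hne, hπ⟩ := exists_strategy_of_mem_ASWinSet (s := s) hwin
    have hσ : ∀ v : S × Bool, ∃ σ : List (S × Bool) → Set A, (∀ w, (σ w).Nonempty) ∧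
        (v ∈ Rlev M P n → ∀ ρ ∈ ConeRel (ImpEnabled M P) [v] σ,
          ∃ f : Fin n → ℕ, StrictMono f ∧ ∀ j, ρ (f j) ∈ ImpFinal) := by
      rintro ⟨t, b⟩
      by_cases hv : (t, b) ∈ Rlev M P n
      · obtain rfl : b = true := Rlev_subset_ImpFinal n hv
        obtain ⟨σ, h₁, h₂⟩ := ih (t, true) hv
        exact ⟨σ, h₁, fun _ => h₂⟩
      · exact ⟨fun _ => Set.univ, fun _ => Set.univ_nonempty, fun h => absurd h hv⟩
    choose σ hσne hσ using hσ
    refine ⟨switchStrategy (s, false) π σ (Rlev M P n),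
      switchStrategy_nonempty hne hσne, fun ρ hρ => ?_⟩
    obtain ⟨i, hi, hsuffix⟩ :=
      exists_mem_cone_of_mem_cone_switchStrategy (v := (s, false)) (v' := (s, m))
        (Δ := ImpEnabled M P) (fun _ _ h => h) hπ hρ
    obtain ⟨f, hmono, hf⟩ := hσ _ hi _ hsuffix
    refine ⟨Fin.cons i fun j => i + 1 + f j, ?_, ?_⟩
    · intro a b hab
      cases b using Fin.cases with
      | zero => exact absurd hab (Fin.not_lt_zero a)
      | succ b =>
        cases a using Fin.cases with
        | zero => simp only [Fin.cons_zero, Fin.cons_succ]; omega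
        | succ a => simpa using hmono (Fin.succ_lt_succ_iff.mp hab)
    · intro j
      cases j using Fin.cases with
      | zero => exact Rlev_subset_ImpFinal n hi
      | succ j => exact hf j

end Improvement

/-- from any state `(s,m)` with `(s,0) ∈ W_k`, some strategy in the
improvement MDP forces every consistent play to visit `𝓕` at least `k` times at
positive indices. -/
theorem rank_many_visits {S A : Type} [Fintype S] [Fintype A]
    (M : MDP S A) (P : PrefModel S) (k : ℕ) (hk : 1 ≤ k) (s : S) (m : Bool)
    (hW : (s, false) ∈ Wlev M P k) :
    ∃ π : List (S × Bool) → Set A, (∀ w, (π w).Nonempty) ∧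
      ∀ ρ ∈ ConeRel (ImpEnabled M P) [(s, m)] π,
        ∃ f : Fin k → ℕ, StrictMono f ∧ (∀ j : Fin k, 1 ≤ f j) ∧
          ∀ j : Fin k, appendSeq [(s, m)] ρ (f j) ∈ ImpFinal := by
  obtain ⟨n, rfl⟩ : ∃ n, k = n + 1 := ⟨k - 1, by omega⟩
  have : Nonempty A := let ⟨_, hne, _⟩ := hW; (hne []).to_type
  obtain ⟨π, hne, hπ⟩ := exists_strategy_visits (n + 1) (s, m) ⟨rfl, hW⟩
  refine ⟨π, hne, fun ρ hρ => ?_⟩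
  obtain ⟨f, hmono, hf⟩ := hπ ρ hρ
  exact ⟨fun j => f j + 1, fun _ _ h => Nat.succ_lt_succ (hmono h), fun _ => Nat.le_add_left _ _,
    fun j => (appendSeq_singleton_succ (s, m) ρ (f j)).symm ▸ hf j⟩
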